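/- Let k : ℕ → ℕ satisfy 1 ≤ k(n) ≤ n for all sufficiently large n and n² / 2^(k(n)²) → ∞ as n → ∞. Then the probability that a uniformly random picture of size n is reconstructible from its k(n)-deck tends to 0 as n → ∞. -/

import Mathlib

open Filter

/-- The `k × k` subgrid of a picture `P` of size `n` with top-left offset `(i, j)`.
When `k ≤ n` and `i, j ≤ n - k`, the guard condition always holds and this is the
genuine subgrid `(a, b) ↦ P (i + a, j + b)`. -/
def subgrid (n k : ℕ) (P : Fin n × Fin n → Bool) (i j : ℕ) : Fin k × Fin k → Bool :=
  fun p =>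
    if h : i + (p.1 : ℕ) < n ∧ j + (p.2 : ℕ) < n then
      P (⟨i + (p.1 : ℕ), h.1⟩, ⟨j + (p.2 : ℕ), h.2⟩)
    else false

/-- The `k`-deck of a picture `P` of size `n`: the multiset, indexed over the
`(n - k + 1)²` pairs `(i, j)` with `0 ≤ i, j ≤ n - k`, of its `k × k` subgrids. -/
def deck (n k : ℕ) (P : Fin n × Fin n → Bool) : Multiset (Fin k × Fin k → Bool) :=
  (Finset.univ : Finset (Fin (n - k + 1) × Fin (n - k + 1))).val.map
    (fun q => subgrid n k P (q.1 : ℕ) (q.2 : ℕ))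

/-- A picture `P` of size `n` is reconstructible from its `k`-deck if every picture
of size `n` with the same `k`-deck equals `P`. -/
def Reconstructible (n k : ℕ) (P : Fin n × Fin n → Bool) : Prop :=
  ∀ P' : Fin n × Fin n → Bool, deck n k P' = deck n k P → P' = P

open scoped Classical in
/-- The probability, under the uniform distribution on the `2 ^ (n²)` pictures of
size `n`, that a random picture is reconstructible from its `k`-deck. -/
noncomputable def reconProb (n k : ℕ) : ℝ :=
  (Finset.univ.filter fun P : Fin n × Fin n → Bool =>
      Reconstructible n k P).card / 2 ^ (n ^ 2)

open scoped Classical in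
lemma recon_card_le (n k : ℕ) :
    (Finset.univ.filter fun P : Fin n × Fin n → Bool => Reconstructible n k P).card
      ≤ (2 ^ (k ^ 2) + (n - k + 1) ^ 2 - 1).choose ((n - k + 1) ^ 2) := by
  have hcard : Fintype.card (Fin k × Fin k → Bool) = 2 ^ (k ^ 2) := by
    simp [sq]
  have hs := Sym.card_sym_eq_choose (α := Fin k × Fin k → Bool) ((n - k + 1) ^ 2)
  rw [hcard] at hs
  rw [← hs, ← Finset.card_univ]
  refine Finset.card_le_card_of_injOn
    (fun P => (⟨deck n k P, by simp [deck, sq]⟩ :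
      Sym (Fin k × Fin k → Bool) ((n - k + 1) ^ 2))) (fun _ _ => Finset.mem_univ _) ?_
  intro P _ Q hQ h
  have hQ' : Reconstructible n k Q := by simpa using hQ
  exact hQ' P (congrArg Subtype.val h)

lemma choose_bound (m N : ℕ) (hm : 1 ≤ m) :
    (((m + N - 1).choose N : ℕ) : ℝ) ≤ (3 / 2) ^ N * 3 ^ m := by
  obtain ⟨r, rfl⟩ : ∃ r, m = r + 1 := ⟨m - 1, by omega⟩
  have e : r + 1 + N - 1 = r + N := by omega
  rw [e]
  have h := add_pow (2 : ℝ) 1 (r + N)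
  have h2 : (2 : ℝ) ^ N * 1 ^ (r + N - N) * ((r + N).choose N : ℕ) ≤ (2 + 1) ^ (r + N) := by
    rw [h]
    exact Finset.single_le_sum
      (f := fun i => (2 : ℝ) ^ i * 1 ^ (r + N - i) * ((r + N).choose i : ℕ))
      (fun i _ => by positivity) (Finset.mem_range.2 (by omega))
  rw [one_pow, mul_one] at h2
  have h3 : (3 / 2 : ℝ) ^ N * 3 ^ (r + 1) = 3 * 3 ^ (r + N) / 2 ^ N := by
    rw [div_pow]; ring
  rw [h3, le_div_iff₀ (by positivity)]
  norm_num at h2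
  have : (0 : ℝ) ≤ 3 ^ (r + N) := by positivity
  linarith

/-- If `k : ℕ → ℕ` satisfies `1 ≤ k n ≤ n` for all sufficiently
large `n` and `n² / 2 ^ (k n)² → ∞`, then the probability that a uniformly
random picture of size `n` is reconstructible from its `k n`-deck tends to `0`. -/
theorem zero_statement (k : ℕ → ℕ)
    (hk : ∀ᶠ n : ℕ in atTop, 1 ≤ k n ∧ k n ≤ n)
    (hlim : Tendsto (fun n : ℕ => (n : ℝ) ^ 2 / 2 ^ (k n ^ 2)) atTop atTop) :
    Tendsto (fun n : ℕ => reconProb n (k n)) atTop (nhds 0) := by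
  have hgeo : Tendsto (fun n : ℕ => (15 / 16 : ℝ) ^ n) atTop (nhds 0) :=
    tendsto_pow_atTop_nhds_zero_of_lt_one (by norm_num) (by norm_num)
  refine tendsto_of_tendsto_of_tendsto_of_le_of_le' tendsto_const_nhds hgeo
    (Eventually.of_forall fun n => by unfold reconProb; positivity) ?_
  filter_upwards [hk, hlim.eventually_ge_atTop 6] with n hkn h6
  rw [le_div_iff₀ (by positivity)] at h6
  set m := 2 ^ (k n ^ 2) with hm
  have h6' : 6 * m ≤ n ^ 2 := by exact_mod_cast h6
  have hm1 : 1 ≤ m := Nat.one_le_two_pow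
  have hN : (n - k n + 1) ^ 2 ≤ n ^ 2 := Nat.pow_le_pow_left (by omega) 2
  have hn : n ≤ n ^ 2 := by nlinarith
  have hA : ((2 : ℝ) ^ (n ^ 2)) * (15 / 16) ^ (n ^ 2) = (3 / 2) ^ (n ^ 2) * (5 / 4) ^ (n ^ 2) := by
    rw [← mul_pow, ← mul_pow]; norm_num
  have hB : (3 : ℝ) ^ m ≤ (5 / 4) ^ (n ^ 2) := by
    calc (3 : ℝ) ^ m ≤ ((5 / 4) ^ 6) ^ m := by gcongr; norm_num
      _ = (5 / 4) ^ (6 * m) := by rw [pow_mul]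
      _ ≤ _ := pow_le_pow_right₀ (by norm_num) h6'
  have hC : (15 / 16 : ℝ) ^ (n ^ 2) ≤ (15 / 16) ^ n :=
    pow_le_pow_of_le_one (by norm_num) (by norm_num) hn
  refine le_trans ?_ hC
  unfold reconProb
  rw [div_le_iff₀ (by positivity), mul_comm, hA]
  calc _ ≤ (((m + (n - k n + 1) ^ 2 - 1).choose ((n - k n + 1) ^ 2) : ℕ) : ℝ) := by
        exact_mod_cast recon_card_le n (k n)
    _ ≤ (3 / 2) ^ ((n - k n + 1) ^ 2) * 3 ^ m := choose_bound _ _ hm1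
    _ ≤ _ := by
        gcongr
        norm_num
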